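/- Assume n ≥ 3. In U(ŝl_{n+1}) the quantum Serre relation Ĕ_{r+2}^{(2)} e_r − Ĕ_{r+2} e_r Ĕ_{r+2} + e_r Ĕ_{r+2}^{(2)} = 0 holds, where Ĕ_{r+2}^{(2)} = Ĕ_{r+2}²/[2]!. -/

import Mathlib

noncomputable section

/-- The field ℚ(v) of rational functions over ℚ. -/
abbrev Qv : Type := RatFunc ℚ

/-- The indeterminate v. -/
def vv : Qv := RatFunc.X

/-- The quantum integer [a] = (v^a - v^{-a})/(v - v⁻¹). -/
def qint (a : ℕ) : Qv := (vv ^ (a : ℤ) - vv ^ (-(a : ℤ))) / (vv - vv⁻¹)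

/-- The quantum factorial [a]! = [a][a-1]⋯[1]. -/
def qfact : ℕ → Qv
  | 0 => 1
  | n + 1 => qint (n + 1) * qfact n

/-- Divided power x^{(p)} = x^p / [p]!. -/
def dp {A : Type} [Ring A] [Algebra Qv A] (x : A) (p : ℕ) : A :=
  (qfact p)⁻¹ • x ^ p

/-- The affine type A Cartan matrix entries c_{ij} = 2δ_{i,j} - δ_{i,j+1} - δ_{i,j-1}. -/
def cartan {m : ℕ} (i j : ZMod m) : ℤ :=
  (if i = j then 2 else 0) - (if i = j + 1 then 1 else 0) - (if i = j - 1 then 1 else 0)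

/-- Generators of the quantum affine algebra U(ŝl_m). -/
inductive Gen (m : ℕ) : Type
  | E : ZMod m → Gen m
  | F : ZMod m → Gen m
  | K : ZMod m → Gen m
  | Kinv : ZMod m → Gen m

abbrev FA (m : ℕ) := FreeAlgebra Qv (Gen m)

def fE {m : ℕ} (i : ZMod m) : FA m := FreeAlgebra.ι Qv (Gen.E i)
def fF {m : ℕ} (i : ZMod m) : FA m := FreeAlgebra.ι Qv (Gen.F i)
def fK {m : ℕ} (i : ZMod m) : FA m := FreeAlgebra.ι Qv (Gen.K i)
def fKinv {m : ℕ} (i : ZMod m) : FA m := FreeAlgebra.ι Qv (Gen.Kinv i)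

/-- The defining relations of the quantum affine algebra U(ŝl_m). -/
inductive URel (m : ℕ) : FA m → FA m → Prop
  | KK : ∀ i j, URel m (fK i * fK j) (fK j * fK i)
  | KKinv : ∀ i, URel m (fK i * fKinv i) 1
  | KinvK : ∀ i, URel m (fKinv i * fK i) 1
  | KE : ∀ i j, URel m (fK i * fE j) (vv ^ cartan i j • (fE j * fK i))
  | KF : ∀ i j, URel m (fK i * fF j) (vv ^ (-cartan i j) • (fF j * fK i))
  | EF : ∀ i j, URel m (fE i * fF j - fF j * fE i)
      (if i = j then (vv - vv⁻¹)⁻¹ • (fK i - fKinv i) else 0)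
  | serreE : ∀ i j, i ≠ j →
      URel m (∑ p ∈ Finset.range ((1 - cartan i j).toNat + 1),
        ((-1 : Qv) ^ p) • (dp (fE i) p * fE j * dp (fE i) ((1 - cartan i j).toNat - p))) 0
  | serreF : ∀ i j, i ≠ j →
      URel m (∑ p ∈ Finset.range ((1 - cartan i j).toNat + 1),
        ((-1 : Qv) ^ p) • (dp (fF i) p * fF j * dp (fF i) ((1 - cartan i j).toNat - p))) 0

/-- The quantum affine algebra U(ŝl_m), presented by generators and relations. -/
abbrev U (m : ℕ) := RingQuot (URel m)

def UE {m : ℕ} (i : ZMod m) : U m := RingQuot.mkAlgHom Qv (URel m) (fE i)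
def UF {m : ℕ} (i : ZMod m) : U m := RingQuot.mkAlgHom Qv (URel m) (fF i)
def UK {m : ℕ} (i : ZMod m) : U m := RingQuot.mkAlgHom Qv (URel m) (fK i)
def UKinv {m : ℕ} (i : ZMod m) : U m := RingQuot.mkAlgHom Qv (URel m) (fKinv i)

/-- The element e_r = Ĕ_r Ĕ_{r+1} − v^ε Ĕ_{r+1} Ĕ_r in U(ŝl_{n+1}). -/
def er (n r : ℕ) (ε : ℤ) : U (n + 1) :=
  UE (r : ZMod (n + 1)) * UE ((r : ZMod (n + 1)) + 1) -
    vv ^ ε • (UE ((r : ZMod (n + 1)) + 1) * UE (r : ZMod (n + 1)))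

/-- The element f_r = F̆_{r+1} F̆_r − v^{−ε} F̆_r F̆_{r+1} in U(ŝl_{n+1}). -/
def fr (n r : ℕ) (ε : ℤ) : U (n + 1) :=
  UF ((r : ZMod (n + 1)) + 1) * UF (r : ZMod (n + 1)) -
    vv ^ (-ε) • (UF (r : ZMod (n + 1)) * UF ((r : ZMod (n + 1)) + 1))

/-- The element k_r = K̆_r K̆_{r+1} in U(ŝl_{n+1}). -/
def kr (n r : ℕ) : U (n + 1) :=
  UK (r : ZMod (n + 1)) * UK ((r : ZMod (n + 1)) + 1)

/-- The image e_i ∈ U(ŝl_{n+1}) of the generator E_i, i ∈ ℤ/nℤ. -/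
def eElt (n r : ℕ) (ε : ℤ) (i : ZMod n) : U (n + 1) :=
  if i.val < r then UE ((i.val : ZMod (n + 1)))
  else if i.val = r then er n r ε
  else UE ((i.val + 1 : ℕ) : ZMod (n + 1))

def fElt (n r : ℕ) (ε : ℤ) (i : ZMod n) : U (n + 1) :=
  if i.val < r then UF ((i.val : ZMod (n + 1)))
  else if i.val = r then fr n r ε
  else UF ((i.val + 1 : ℕ) : ZMod (n + 1))

def kElt (n r : ℕ) (i : ZMod n) : U (n + 1) :=
  if i.val < r then UK ((i.val : ZMod (n + 1)))
  else if i.val = r then kr n r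
  else UK ((i.val + 1 : ℕ) : ZMod (n + 1))

def kinvElt (n r : ℕ) (i : ZMod n) : U (n + 1) :=
  if i.val < r then UKinv ((i.val : ZMod (n + 1)))
  else if i.val = r then UKinv (r : ZMod (n + 1)) * UKinv ((r : ZMod (n + 1)) + 1)
  else UKinv ((i.val + 1 : ℕ) : ZMod (n + 1))


lemma vv_sub_inv_ne_zero : vv - vv⁻¹ ≠ 0 := by
  intro h
  have h1 : vv ^ 2 = 1 := by
    have h0 : vv ≠ 0 := RatFunc.X_ne_zero
    rw [pow_two]
    nth_rewrite 2 [sub_eq_zero.mp h]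
    exact mul_inv_cancel₀ h0
  have h2 : (Polynomial.X : Polynomial ℚ) ^ 2 = 1 := by
    apply RatFunc.algebraMap_injective ℚ
    rw [map_pow, RatFunc.algebraMap_X, map_one]
    exact h1
  simpa using congrArg (Polynomial.eval 0) h2

lemma qint_one : qint 1 = 1 := by
  simp [qint, div_self vv_sub_inv_ne_zero]

section DividedPowers

variable {A : Type} [Ring A] [Algebra Qv A]

@[simp] lemma dp_zero (x : A) : dp x 0 = 1 := by simp [dp, qfact]

@[simp] lemma dp_one (x : A) : dp x 1 = x := by simp [dp, qfact, qint_one]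

lemma Commute.dp_right {x y : A} (h : Commute x y) (p : ℕ) : Commute x (dp y p) :=
  (h.pow_right p).smul_right _

lemma serre_sum_one (x y : A) :
    ∑ p ∈ Finset.range 2, ((-1 : Qv) ^ p) • (dp x p * y * dp x (1 - p)) = y * x - x * y := by
  simp [Finset.sum_range_succ, sub_eq_add_neg]

lemma serre_sum_two (x y : A) :
    ∑ p ∈ Finset.range 3, ((-1 : Qv) ^ p) • (dp x p * y * dp x (2 - p)) =
      dp x 2 * y - x * y * x + y * dp x 2 := by
  simp [Finset.sum_range_succ]
  abel

/-- If `c` commutes with `a` and satisfies the quantum Serre relation with `b`, then it satisfies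
the same relation with every `q`-commutator of `a` and `b`. -/
lemma serre_qcommutator {a b c : A} (q : Qv) (h : Commute a c)
    (hs : dp c 2 * b - c * b * c + b * dp c 2 = 0) :
    dp c 2 * (a * b - q • (b * a)) - c * (a * b - q • (b * a)) * c +
      (a * b - q • (b * a)) * dp c 2 = 0 := by
  have hd : a * dp c 2 = dp c 2 * a := h.dp_right 2
  have hc : a * c = c * a := h
  calc
    _ = a * (dp c 2 * b - c * b * c + b * dp c 2) -
        q • ((dp c 2 * b - c * b * c + b * dp c 2) * a) := by
      simp only [mul_sub, sub_mul, mul_add, add_mul, smul_sub, smul_add, mul_smul_comm,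
        smul_mul_assoc, mul_assoc, hd, hc]
      simp only [← mul_assoc, hd, hc]
      abel
    _ = 0 := by simp [hs]

end DividedPowers

section SerreRelations

variable {m : ℕ} {i j : ZMod m}

lemma map_dp {A B : Type} [Ring A] [Algebra Qv A] [Ring B] [Algebra Qv B] (f : A →ₐ[Qv] B)
    (x : A) (p : ℕ) : f (dp x p) = dp (f x) p := by
  simp [dp]

lemma UE_serre (hij : i ≠ j) :
    ∑ p ∈ Finset.range ((1 - cartan i j).toNat + 1),
      ((-1 : Qv) ^ p) • (dp (UE i) p * UE j * dp (UE i) ((1 - cartan i j).toNat - p)) = 0 := by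
  have h := RingQuot.mkAlgHom_rel Qv (URel.serreE i j hij)
  simp only [map_sum, map_smul, map_mul, map_dp, map_zero] at h
  exact h

lemma UE_commute (hij : i ≠ j) (h : cartan i j = 0) : Commute (UE j) (UE i) := by
  have hs := UE_serre hij
  rw [h] at hs
  exact sub_eq_zero.mp ((serre_sum_one _ _).symm.trans hs)

lemma UE_serre_of_adjacent (hij : i ≠ j) (h : cartan i j = -1) :
    dp (UE i) 2 * UE j - UE i * UE j * UE i + UE j * dp (UE i) 2 = 0 := by
  have hs := UE_serre hij
  rw [h] at hs
  exact (serre_sum_two _ _).symm.trans hs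

end SerreRelations

lemma ZMod.natCast_ne_zero_of_lt {m k : ℕ} (hk : 0 < k) (hkm : k < m) : (k : ZMod m) ≠ 0 := by
  rw [Ne, ZMod.natCast_eq_zero_iff]
  exact Nat.not_dvd_of_pos_of_lt hk hkm

/-- For n ≥ 3, the quantum Serre relation between Ĕ_{r+2} and e_r. -/
theorem serre_Erp2_er
    (n r : ℕ) (hn : 3 ≤ n) (hr : r ≤ n - 1) (ε : ℤ) (hε : ε = 1 ∨ ε = -1) :
    dp (UE ((r : ZMod (n + 1)) + 2)) 2 * er n r ε -
      UE ((r : ZMod (n + 1)) + 2) * er n r ε * UE ((r : ZMod (n + 1)) + 2) +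
      er n r ε * dp (UE ((r : ZMod (n + 1)) + 2)) 2 = 0 := by
  have h1 : (1 : ZMod (n + 1)) ≠ 0 := by
    exact_mod_cast ZMod.natCast_ne_zero_of_lt (m := n + 1) (k := 1) (by lia) (by lia)
  have h2 : (2 : ZMod (n + 1)) ≠ 0 := by
    exact_mod_cast ZMod.natCast_ne_zero_of_lt (m := n + 1) (k := 2) (by lia) (by lia)
  have h3 : (3 : ZMod (n + 1)) ≠ 0 := by
    exact_mod_cast ZMod.natCast_ne_zero_of_lt (m := n + 1) (k := 3) (by lia) (by lia)
  generalize hx : (r : ZMod (n + 1)) = x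
  have n0 : x + 2 ≠ x := fun h => h2 (by linear_combination h)
  have n1 : x + 2 ≠ x + 1 := fun h => h1 (by linear_combination h)
  have n2 : x + 2 ≠ x - 1 := fun h => h3 (by linear_combination h)
  have n3 : x + 2 = x + 1 + 1 := by ring
  have n4 : x + 2 ≠ x + 1 - 1 := fun h => h2 (by linear_combination h)
  rw [er, hx]
  refine serre_qcommutator _ (UE_commute n0 ?_) (UE_serre_of_adjacent n1 ?_)
  · rw [cartan, if_neg n0, if_neg n1, if_neg n2]
    norm_num
  · rw [cartan, if_neg n1, if_pos n3, if_neg n4]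
    norm_num

end
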